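/- arXiv:1811.12545 — 4 statements merged into one kernel-verified Lean document; each statement's English description precedes it below -/
import Mathlib

section
/- For every y with 0 < y < 1/(4√3) and every r ∈ ℝ, one has ∫_{−2√3·y}^{2√3·y} |C_γ(r + t) − C_γ(r)| dt ≤ 11 · y^(3/2). -/
open MeasureTheory Complex Set Filter

/-- The arcsine distribution on ℝ with density `1/(π√(2-t²))` on `(-√2, √2)`. -/
noncomputable def arcsine : Measure ℝ :=
  MeasureTheory.volume.withDensity fun t =>
    ENNReal.ofReal (if t ^ 2 < 2 then (Real.pi * Real.sqrt (2 - t ^ 2))⁻¹ else 0)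

/-- Cumulative distribution function of a Borel measure on ℝ. -/
noncomputable def cdfOf (τ : Measure ℝ) (x : ℝ) : ℝ := (τ (Set.Iic x)).toReal

lemma sin_arcsin_eq_max_min (x : ℝ) : Real.sin (Real.arcsin x) = max (-1) (min 1 x) := by
  rw [← Real.arcsin_projIcc]
  exact Real.sin_arcsin (Set.projIcc _ _ _ x).2.1 (Set.projIcc _ _ _ x).2.2

lemma sin_arcsin_sub_sin_arcsin_le {u v : ℝ} (h : u ≤ v) :
    Real.sin (Real.arcsin v) - Real.sin (Real.arcsin u) ≤ v - u := by
  rw [sin_arcsin_eq_max_min, sin_arcsin_eq_max_min]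
  grind

/-- The arcsine function is `1/2`-Hölder on the whole line. -/
lemma arcsin_sub_arcsin_sq_le {u v : ℝ} (h : u ≤ v) :
    (Real.arcsin v - Real.arcsin u) ^ 2 ≤ Real.pi ^ 2 / 2 * (v - u) := by
  have hle := Real.arcsin_le_arcsin h
  have hu := Real.neg_pi_div_two_le_arcsin u
  have hv := Real.arcsin_le_pi_div_two v
  set δ := (Real.arcsin v - Real.arcsin u) / 2 with hδ
  have hδ0 : 0 ≤ δ := by linarith
  have hδ1 : δ ≤ Real.pi / 2 := by linarith
  have hjordan : 2 / Real.pi * δ ≤ Real.sin δ := Real.mul_le_sin hδ0 hδ1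
  have hsin : 0 ≤ Real.sin δ := le_trans (by positivity) hjordan
  have hcos : Real.sin δ ≤ Real.cos ((Real.arcsin v + Real.arcsin u) / 2) := by
    rw [← Real.cos_pi_div_two_sub, ← Real.cos_abs ((Real.arcsin v + Real.arcsin u) / 2)]
    apply Real.cos_le_cos_of_nonneg_of_le_pi (abs_nonneg _) (by linarith)
    rw [abs_le]
    constructor <;> linarith
  have hsub := sin_arcsin_sub_sin_arcsin_le h
  rw [Real.sin_sub_sin] at hsub
  have hsq : (2 / Real.pi * δ) ^ 2 ≤ Real.sin δ ^ 2 := by gcongr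
  have hmul : Real.sin δ ^ 2 ≤ (v - u) / 2 := by nlinarith
  have hpi := Real.pi_pos
  have heq : (Real.arcsin v - Real.arcsin u) ^ 2 = Real.pi ^ 2 * (2 / Real.pi * δ) ^ 2 := by
    rw [hδ]; field_simp
  rw [heq]
  nlinarith [mul_le_mul_of_nonneg_left (hsq.trans hmul) (sq_nonneg Real.pi)]

lemma monotone_arcsin_div_sqrt_two_div_pi :
    Monotone fun t : ℝ => Real.arcsin (t / √2) / Real.pi := by
  intro a b hab
  have := Real.pi_pos
  dsimp only
  gcongr

lemma deriv_arcsin_div_sqrt_two_div_pi (t : ℝ) :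
    deriv (fun t : ℝ => Real.arcsin (t / √2) / Real.pi) t =
      if t ^ 2 < 2 then (Real.pi * √(2 - t ^ 2))⁻¹ else 0 := by
  have h2 : (√2 : ℝ) ≠ 0 := by positivity
  have hcomp : deriv (fun t : ℝ => Real.arcsin (t / √2)) t = (√2)⁻¹ * (1 / √(1 - (t / √2) ^ 2)) := by
    have := deriv_comp_mul_left (√2)⁻¹ Real.arcsin t
    simp only [Real.deriv_arcsin, smul_eq_mul] at this
    simpa only [div_eq_inv_mul _ (√2)] using this
  have hsqrt : √2 * √(1 - (t / √2) ^ 2) = √(2 - t ^ 2) := by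
    rw [← Real.sqrt_mul (by norm_num), div_pow, Real.sq_sqrt (by norm_num)]
    congr 1
    ring
  rw [deriv_div_const, hcomp, one_div, ← mul_inv, hsqrt]
  split_ifs with h
  · rw [mul_inv, div_eq_inv_mul]
  · rw [Real.sqrt_eq_zero_of_nonpos (by linarith)]
    simp

lemma arcsine_Ioc_le {a b : ℝ} (hab : a ≤ b) :
    arcsine (Ioc a b) ≤ ENNReal.ofReal √((b - a) / 2) := by
  set F : ℝ → ℝ := fun t => Real.arcsin (t / √2) / Real.pi with hF
  have hmono : Monotone F := monotone_arcsin_div_sqrt_two_div_pi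
  have hint := (hmono.monotoneOn (uIcc a b)).intervalIntegrable_deriv
  have hmem := (hmono.monotoneOn (uIcc a b)).intervalIntegral_deriv_mem_uIcc
  rw [uIcc_of_le (sub_nonneg.2 (hmono hab)), intervalIntegral.integral_of_le hab] at hmem
  rw [intervalIntegrable_iff_integrableOn_Ioc_of_le hab] at hint
  have hnonneg : ∀ t, 0 ≤ deriv F t := fun t => hmono.deriv_nonneg
  rw [arcsine, withDensity_apply _ measurableSet_Ioc]
  simp_rw [← deriv_arcsin_div_sqrt_two_div_pi]
  rw [← ofReal_integral_eq_lintegral_ofReal hint (ae_of_all _ hnonneg)]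
  apply ENNReal.ofReal_le_ofReal (hmem.2.trans (Real.le_sqrt_of_sq_le _))
  have h2 : (1 : ℝ) ≤ √2 := Real.one_le_sqrt.2 (by norm_num)
  have hpi := Real.pi_pos
  have hdiv : b / √2 - a / √2 ≤ b - a := by
    rw [← sub_div]
    exact div_le_self (sub_nonneg.2 hab) h2
  have hsq := arcsin_sub_arcsin_sq_le (show a / √2 ≤ b / √2 by gcongr)
  simp only [hF]
  rw [← sub_div, div_pow, div_le_iff₀ (by positivity)]
  nlinarith [mul_le_mul_of_nonneg_left hdiv (sq_nonneg Real.pi)]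

lemma abs_cdfOf_sub_le {τ : Measure ℝ} {a b c : ℝ} (hab : a ≤ b) (hc : 0 ≤ c)
    (h : τ (Ioc a b) ≤ ENNReal.ofReal c) : |cdfOf τ b - cdfOf τ a| ≤ c := by
  have hsub : τ (Iic a) ≤ τ (Iic b) := measure_mono (Iic_subset_Iic.2 hab)
  have hadd : τ (Iic b) ≤ τ (Iic a) + ENNReal.ofReal c := by
    rw [← Iic_union_Ioc_eq_Iic hab]
    exact (measure_union_le _ _).trans (by gcongr)
  unfold cdfOf
  by_cases htop : τ (Iic a) = ⊤
  · have : τ (Iic b) = ⊤ := top_le_iff.1 (htop ▸ hsub)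
    simpa [htop, this] using hc
  · have hfin : τ (Iic a) + ENNReal.ofReal c ≠ ⊤ := by simp [htop]
    have h1 := ENNReal.toReal_mono (ne_top_of_le_ne_top hfin hadd) hsub
    have h2 := ENNReal.toReal_mono hfin hadd
    rw [ENNReal.toReal_add htop ENNReal.ofReal_ne_top, ENNReal.toReal_ofReal hc] at h2
    rw [abs_le]
    constructor <;> linarith

lemma abs_cdfOf_arcsine_sub_le (r t : ℝ) :
    |cdfOf arcsine (r + t) - cdfOf arcsine r| ≤ √(|t| / 2) := by
  rcases le_total 0 t with ht | ht
  · have hle : r ≤ r + t := by linarith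
    refine abs_cdfOf_sub_le hle (Real.sqrt_nonneg _) ((arcsine_Ioc_le hle).trans_eq ?_)
    rw [abs_of_nonneg ht, add_sub_cancel_left]
  · have hle : r + t ≤ r := by linarith
    rw [abs_sub_comm]
    refine abs_cdfOf_sub_le hle (Real.sqrt_nonneg _) ((arcsine_Ioc_le hle).trans_eq ?_)
    rw [abs_of_nonpos ht, sub_add_cancel_left]

/-- Modulus-of-continuity estimate for the arcsine cdf appearing in
Bai's inequality: for `0 < y < 1/(4√3)` and any `r ∈ ℝ`,
`∫_{|t| ≤ 2√3 y} |C_γ(r+t) - C_γ(r)| dt ≤ 11 y^{3/2}`. -/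
theorem arcsine_cdf_integral_estimate
    (y : ℝ) (hy0 : 0 < y) (hy1 : y < 1 / (4 * Real.sqrt 3)) (r : ℝ) :
    (∫ t in Set.Icc (-(2 * Real.sqrt 3 * y)) (2 * Real.sqrt 3 * y),
        |cdfOf arcsine (r + t) - cdfOf arcsine r|)
      ≤ 11 * y ^ ((3 : ℝ) / 2) := by
  have hbound : ∀ t ∈ Icc (-(2 * √3 * y)) (2 * √3 * y),
      ‖|cdfOf arcsine (r + t) - cdfOf arcsine r|‖ ≤ √(√3 * y) := by
    intro t ht
    rw [Real.norm_eq_abs, abs_abs]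
    refine (abs_cdfOf_arcsine_sub_le r t).trans (Real.sqrt_le_sqrt ?_)
    linarith [abs_le.2 ht]
  have hint := (le_abs_self _).trans
    (norm_setIntegral_le_of_norm_le_const (μ := volume) (by simp) hbound)
  have hvol : volume.real (Icc (-(2 * √3 * y)) (2 * √3 * y)) = 4 * √3 * y := by
    rw [Real.volume_real_Icc_of_le (by linarith [show 0 ≤ 2 * √3 * y by positivity])]
    ring
  rw [hvol, Real.sqrt_mul (by positivity)] at hint
  have hpow : y ^ ((3 : ℝ) / 2) = y * √y := by
    rw [show (3 : ℝ) / 2 = 1 + 1 / 2 by norm_num, Real.rpow_add hy0, Real.rpow_one,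
      ← Real.sqrt_eq_rpow]
  have hconst : √√3 * (4 * √3) ≤ 11 := by
    have h3 : √3 ≤ 2 := Real.sqrt_le_iff.2 (by norm_num)
    refine abs_le_of_sq_le_sq' ?_ (by norm_num) |>.2
    rw [mul_pow, mul_pow, Real.sq_sqrt (by positivity), Real.sq_sqrt (by norm_num)]
    linarith
  rw [hpow]
  calc _ ≤ √√3 * √y * (4 * √3 * y) := hint
    _ = √√3 * (4 * √3) * (y * √y) := by ring
    _ ≤ 11 * (y * √y) := by gcongr
end

section
/- Let ν be a finite Borel measure on ℝ with ν(ℝ) = 1 and let k be a positive integer with ν([−k, k]) ≥ 0.9. Let G_ν(z) = ∫_ℝ (z − t)⁻¹ dν(t) for z ∈ ℂ⁺. Then for every z = x + iy with y ≥ 2k + 2: if y − 1 ≤ x ≤ y then Re G_ν(z) > 0, and if −y ≤ x ≤ −y + 1 then Re G_ν(z) < 0. -/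
open MeasureTheory Complex Set Filter

lemma cauchyKernel_re (x y t : ℝ) :
    (((x : ℂ) + y * Complex.I) - (t : ℂ))⁻¹.re = (x - t) / ((x - t) ^ 2 + y ^ 2) := by
  simp [Complex.inv_re, Complex.normSq_apply, pow_two]

lemma integrable_cauchyKernel (ν : Measure ℝ) [IsFiniteMeasure ν] (x : ℝ) {y : ℝ} (hy : 0 < y) :
    Integrable (fun t : ℝ => (((x : ℂ) + y * Complex.I) - (t : ℂ))⁻¹) ν := by
  refine Integrable.of_bound (C := y⁻¹) (by fun_prop) (Eventually.of_forall fun t => ?_)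
  rw [norm_inv]
  gcongr
  simpa [abs_of_pos hy] using
    (le_abs_self _).trans (Complex.abs_im_le_norm (((x : ℂ) + y * Complex.I) - (t : ℂ)))

lemma re_integral_cauchyKernel (ν : Measure ℝ) [IsFiniteMeasure ν] (x : ℝ) {y : ℝ} (hy : 0 < y) :
    (∫ t, (((x : ℂ) + y * Complex.I) - (t : ℂ))⁻¹ ∂ν).re
      = ∫ t, (x - t) / ((x - t) ^ 2 + y ^ 2) ∂ν := by
  have h := Complex.reCLM.integral_comp_comm (integrable_cauchyKernel ν x hy)
  simpa only [Complex.reCLM_apply, cauchyKernel_re] using h.symm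

lemma integrable_cauchyKernel_re (ν : Measure ℝ) [IsFiniteMeasure ν] (x : ℝ) {y : ℝ}
    (hy : 0 < y) : Integrable (fun t : ℝ => (x - t) / ((x - t) ^ 2 + y ^ 2)) ν := by
  have h := Complex.reCLM.integrable_comp (integrable_cauchyKernel ν x hy)
  simpa only [Complex.reCLM_apply, cauchyKernel_re] using h

lemma neg_inv_two_mul_le_div (s : ℝ) {y : ℝ} (hy : 0 < y) :
    -(1 / (2 * y)) ≤ s / (s ^ 2 + y ^ 2) := by
  rw [← neg_div, div_le_div_iff₀ (by positivity) (by positivity)]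
  nlinarith [sq_nonneg (s + y)]

lemma two_div_five_mul_le_div {s y : ℝ} (hy : 0 < y) (h₁ : y / 2 ≤ s) (h₂ : s ≤ 3 * y / 2) :
    2 / (5 * y) ≤ s / (s ^ 2 + y ^ 2) := by
  rw [div_le_div_iff₀ (by positivity) (by positivity)]
  nlinarith [mul_nonneg (sub_nonneg.2 h₁) (sub_nonneg.2 h₂)]

/-- A function bounded below by `-a` everywhere and by `b` on a set of mass at least `m` has
positive integral against a probability measure as soon as `a < (b + a) * m`. -/
lemma integral_pos_of_le_on {α : Type*} [MeasurableSpace α] {ν : Measure α}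
    [IsProbabilityMeasure ν] {f : α → ℝ} (hf : Integrable f ν) {s : Set α}
    (hs : MeasurableSet s) {a b m : ℝ} (hm : m ≤ ν.real s) (hab : 0 ≤ b + a)
    (hfa : ∀ t, -a ≤ f t) (hfb : ∀ t ∈ s, b ≤ f t) (h : a < (b + a) * m) :
    0 < ∫ t, f t ∂ν := by
  have hi : Integrable (s.indicator fun _ => b + a) ν := (integrable_const _).indicator hs
  have hle : ∫ t, (s.indicator (fun _ => b + a) t - a) ∂ν ≤ ∫ t, f t ∂ν := by
    refine integral_mono (hi.sub (integrable_const a)) hf fun t => ?_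
    by_cases ht : t ∈ s
    · simpa [ht] using hfb t ht
    · simpa [ht] using hfa t
  rw [integral_sub hi (integrable_const a), integral_indicator_const _ hs] at hle
  simp only [integral_const, probReal_univ, smul_eq_mul, one_mul] at hle
  nlinarith [mul_le_mul_of_nonneg_left hm hab]

/-- Sign of the real part of the Cauchy transform `G_ν` on the lateral strips
of the truncated cone: `Re G_ν > 0` on the right strip and `Re G_ν < 0` on the
left strip. -/
theorem cauchy_transform_real_part_sign
    (ν : Measure ℝ) [IsFiniteMeasure ν] (hν1 : ν Set.univ = 1)
    (k : ℕ) (hk : 1 ≤ k)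
    (hνk : ENNReal.ofReal 0.9 ≤ ν (Set.Icc (-(k : ℝ)) (k : ℝ))) :
    ∀ x y : ℝ, 2 * (k : ℝ) + 2 ≤ y →
      ((y - 1 ≤ x ∧ x ≤ y) →
        0 < (∫ t, (((x : ℂ) + y * Complex.I) - (t : ℂ))⁻¹ ∂ν).re) ∧
      ((-y ≤ x ∧ x ≤ -y + 1) →
        (∫ t, (((x : ℂ) + y * Complex.I) - (t : ℂ))⁻¹ ∂ν).re < 0) := by
  intro x y hky
  have : IsProbabilityMeasure ν := ⟨hν1⟩
  have hk0 : (0 : ℝ) ≤ k := k.cast_nonneg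
  have hy : 0 < y := by linarith
  have hm : (0.9 : ℝ) ≤ ν.real (Icc (-(k : ℝ)) k) :=
    (ENNReal.ofReal_le_iff_le_toReal (measure_ne_top _ _)).1 hνk
  have hab : 1 / (2 * y) < (2 / (5 * y) + 1 / (2 * y)) * 0.9 := by
    field_simp
    norm_num
  have hint := integrable_cauchyKernel_re ν x hy
  have hneg (t : ℝ) : -((x - t) / ((x - t) ^ 2 + y ^ 2)) = (t - x) / ((t - x) ^ 2 + y ^ 2) := by
    rw [← neg_div, neg_sub, sub_sq_comm]
  rw [re_integral_cauchyKernel ν x hy]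
  constructor
  · rintro ⟨h₁, h₂⟩
    refine integral_pos_of_le_on hint measurableSet_Icc hm (by positivity)
      (fun t => neg_inv_two_mul_le_div _ hy) (fun t ht => ?_) hab
    exact two_div_five_mul_le_div hy (by linarith [ht.2]) (by linarith [ht.1])
  · rintro ⟨h₁, h₂⟩
    rw [← neg_pos, ← integral_neg]
    refine integral_pos_of_le_on hint.neg measurableSet_Icc hm (by positivity)
      (fun t => ?_) (fun t ht => ?_) hab
    · exact (neg_inv_two_mul_le_div _ hy).trans_eq (hneg t).symm
    · exact (two_div_five_mul_le_div hy (by linarith [ht.1])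
        (by linarith [ht.2])).trans_eq (hneg t).symm
end

section
/- Let ν be a finite Borel measure on ℝ with ν(ℝ) = 1 and define F : ℂ⁺ → ℂ⁺ by F(z) = z + ∫_ℝ (t − z)⁻¹ dν(t). Let k be a positive integer with ν([−k, k]) ≥ 0.9 and set z = (2k + 2)i. Then lim_{j → ∞} (F^{∘j}(z))² / j = −2. -/
open MeasureTheory Complex Set Filter

lemma im_le_norm_ofReal_sub (t : ℝ) {z : ℂ} (hz : 0 < z.im) : z.im ≤ ‖(t : ℂ) - z‖ := by
  simpa [abs_of_pos hz] using abs_im_le_norm ((t : ℂ) - z)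

lemma norm_inv_ofReal_sub_le (t : ℝ) {z : ℂ} (hz : 0 < z.im) :
    ‖((t : ℂ) - z)⁻¹‖ ≤ z.im⁻¹ := by
  rw [norm_inv]
  exact inv_anti₀ hz (im_le_norm_ofReal_sub t hz)

lemma integrable_inv_ofReal_sub (ν : Measure ℝ) [IsFiniteMeasure ν] {z : ℂ} (hz : 0 < z.im) :
    Integrable (fun t : ℝ => ((t : ℂ) - z)⁻¹) ν :=
  Integrable.of_bound (by fun_prop) z.im⁻¹
    (Eventually.of_forall fun t => norm_inv_ofReal_sub_le t hz)

lemma norm_integral_inv_ofReal_sub_le (ν : Measure ℝ) [IsProbabilityMeasure ν] {z : ℂ}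
    (hz : 0 < z.im) : ‖∫ t, ((t : ℂ) - z)⁻¹ ∂ν‖ ≤ z.im⁻¹ := by
  simpa using norm_integral_le_of_norm_le_const (μ := ν)
    (Eventually.of_forall fun t => norm_inv_ofReal_sub_le t hz)

lemma inv_ofReal_sub_re (t : ℝ) (z : ℂ) :
    (((t : ℂ) - z)⁻¹).re = (t - z.re) / ((t - z.re) ^ 2 + z.im ^ 2) := by
  simp [inv_re, normSq_apply, sq]

lemma inv_ofReal_sub_im (t : ℝ) (z : ℂ) :
    (((t : ℂ) - z)⁻¹).im = z.im / ((t - z.re) ^ 2 + z.im ^ 2) := by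
  simp [inv_im, normSq_apply, sq]

/-- A function bounded by `a` on a set of measure at least `p` and by `b ≥ a` elsewhere has
integral at most `p * a + (1 - p) * b`. -/
lemma integral_le_of_le_on_of_le {ν : Measure ℝ} [IsProbabilityMeasure ν] {S : Set ℝ}
    (hS : MeasurableSet S) {p a b : ℝ} (hp : p ≤ ν.real S) (hab : a ≤ b) {f : ℝ → ℝ}
    (hf : Integrable f ν) (ha : ∀ t ∈ S, f t ≤ a) (hb : ∀ t, f t ≤ b) :
    ∫ t, f t ∂ν ≤ p * a + (1 - p) * b := by
  have hind : Integrable (S.indicator fun _ => a - b) ν :=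
    (integrable_const (a - b)).indicator hS
  calc ∫ t, f t ∂ν ≤ ∫ t, (b + S.indicator (fun _ => a - b) t) ∂ν := by
        refine integral_mono hf ((integrable_const b).add hind) fun t => ?_
        by_cases ht : t ∈ S
        · simpa [ht] using ha t ht
        · simpa [ht] using hb t
    _ = b + ν.real S * (a - b) := by
        rw [integral_add (integrable_const b) hind, integral_indicator_const _ hS]
        simp
    _ ≤ p * a + (1 - p) * b := by nlinarith

/-- In the cone `|re z| ≤ im z`, `2 * k ≤ im z`, points of `[-k, k]` are within `2 * im z` of `z`. -/
lemma sq_add_sq_le_of_mem_Icc {k t : ℝ} {z : ℂ} (hk : 2 * k ≤ z.im) (hre : |z.re| ≤ z.im)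
    (ht : t ∈ Icc (-k) k) : (t - z.re) ^ 2 + z.im ^ 2 ≤ 13 / 4 * z.im ^ 2 := by
  obtain ⟨h1, h2⟩ := abs_le.1 hre
  obtain ⟨h3, h4⟩ := ht
  nlinarith [mul_nonneg (by linarith : 0 ≤ 3 / 2 * z.im - (t - z.re))
    (by linarith : 0 ≤ 3 / 2 * z.im + (t - z.re))]

lemma le_im_integral_inv_ofReal_sub {ν : Measure ℝ} [IsProbabilityMeasure ν] {k : ℝ}
    (hν : 0.9 ≤ ν.real (Icc (-k) k)) {z : ℂ} (hz : 0 < z.im) (hk : 2 * k ≤ z.im)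
    (hre : |z.re| ≤ z.im) : (4 * z.im)⁻¹ ≤ (∫ t, ((t : ℂ) - z)⁻¹ ∂ν).im := by
  have hint := integrable_inv_ofReal_sub ν hz
  have him : (∫ t, ((t : ℂ) - z)⁻¹ ∂ν).im = -∫ t, -(((t : ℂ) - z)⁻¹).im ∂ν := by
    rw [integral_neg, neg_neg]
    exact (imCLM.integral_comp_comm hint).symm
  have hbound := integral_le_of_le_on_of_le (a := -(4 / 13 * z.im⁻¹)) (b := 0)
    measurableSet_Icc hν (by simp; positivity) (imCLM.integrable_comp hint).neg
    (fun t ht => by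
      simp only [Pi.neg_apply, imCLM_apply, inv_ofReal_sub_im]
      rw [neg_le_neg_iff, le_div_iff₀ (by positivity)]
      calc 4 / 13 * z.im⁻¹ * ((t - z.re) ^ 2 + z.im ^ 2)
          ≤ 4 / 13 * z.im⁻¹ * (13 / 4 * z.im ^ 2) := by
            gcongr; exact sq_add_sq_le_of_mem_Icc hk hre ht
        _ = z.im := by field_simp)
    (fun t => by
      simp only [Pi.neg_apply, imCLM_apply, inv_ofReal_sub_im]
      have : 0 ≤ z.im / ((t - z.re) ^ 2 + z.im ^ 2) := by positivity
      linarith)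
  simp only [Pi.neg_apply, imCLM_apply] at hbound
  have hpos := inv_pos.2 hz
  rw [him, mul_inv]
  linarith

lemma mul_re_integral_inv_ofReal_sub_le_im {ν : Measure ℝ} [IsProbabilityMeasure ν] {k : ℝ}
    (hν : 0.9 ≤ ν.real (Icc (-k) k)) {z : ℂ} (hz : 0 < z.im) (hk : 2 * k ≤ z.im)
    (hre : |z.re| ≤ z.im) {s : ℝ} (hs : s ^ 2 = 1) (hkz : ∀ t ∈ Icc (-k) k, s * t ≤ s * z.re) :
    s * (∫ t, ((t : ℂ) - z)⁻¹ ∂ν).re ≤ (∫ t, ((t : ℂ) - z)⁻¹ ∂ν).im := by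
  have hint := integrable_inv_ofReal_sub ν hz
  have hintre : Integrable (fun t : ℝ => s * (((t : ℂ) - z)⁻¹).re) ν :=
    (reCLM.integrable_comp hint).const_mul s
  have hintim : Integrable (fun t : ℝ => (((t : ℂ) - z)⁻¹).im) ν := imCLM.integrable_comp hint
  have hpos := inv_pos.2 hz
  have heq : s * (∫ t, ((t : ℂ) - z)⁻¹ ∂ν).re - (∫ t, ((t : ℂ) - z)⁻¹ ∂ν).im
      = ∫ t, (s * (((t : ℂ) - z)⁻¹).re - (((t : ℂ) - z)⁻¹).im) ∂ν := by
    rw [integral_sub hintre hintim, integral_const_mul]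
    congr 1
    · exact congrArg (s * ·) (reCLM.integral_comp_comm hint).symm
    · exact (imCLM.integral_comp_comm hint).symm
  have hform (t : ℝ) : s * (((t : ℂ) - z)⁻¹).re - (((t : ℂ) - z)⁻¹).im
      = (s * (t - z.re) - z.im) / ((t - z.re) ^ 2 + z.im ^ 2) := by
    rw [inv_ofReal_sub_re, inv_ofReal_sub_im]
    ring
  have hbound := integral_le_of_le_on_of_le (a := -(4 / 13 * z.im⁻¹)) (b := z.im⁻¹ / 2)
    measurableSet_Icc hν (by linarith) (hintre.sub hintim)
    (fun t ht => by
      simp only [Pi.sub_apply, hform]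
      rw [div_le_iff₀ (by positivity)]
      have : 4 / 13 * z.im⁻¹ * ((t - z.re) ^ 2 + z.im ^ 2)
          ≤ 4 / 13 * z.im⁻¹ * (13 / 4 * z.im ^ 2) := by
        gcongr; exact sq_add_sq_le_of_mem_Icc hk hre ht
      have h2 : 4 / 13 * z.im⁻¹ * (13 / 4 * z.im ^ 2) = z.im := by field_simp
      linarith [hkz t ht])
    (fun t => by
      simp only [Pi.sub_apply, hform]
      rw [div_le_iff₀ (by positivity), div_mul_eq_mul_div, inv_mul_eq_div, div_div,
        le_div_iff₀ (by positivity)]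
      have : (t - z.re) ^ 2 = (s * (t - z.re)) ^ 2 := by rw [mul_pow, hs, one_mul]
      rw [this]
      nlinarith [sq_nonneg (s * (t - z.re) - z.im)])
  simp only [Pi.sub_apply] at hbound
  linarith

/-- One step of the iteration preserves the cone `|re z| ≤ im z`. -/
lemma abs_re_add_integral_le {ν : Measure ℝ} [IsProbabilityMeasure ν] {k : ℝ} (hk : 0 ≤ k)
    (hν : 0.9 ≤ ν.real (Icc (-k) k)) {z : ℂ} (hz : 2 * k + 2 ≤ z.im) (hre : |z.re| ≤ z.im) :
    |(z + ∫ t, ((t : ℂ) - z)⁻¹ ∂ν).re| ≤ (z + ∫ t, ((t : ℂ) - z)⁻¹ ∂ν).im := by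
  have hpos : 0 < z.im := by linarith
  have him := le_im_integral_inv_ofReal_sub hν hpos (by linarith) hre
  have him' : 0 < (4 * z.im)⁻¹ := by positivity
  have hnorm := (abs_re_le_norm _).trans (norm_integral_inv_ofReal_sub_le ν hpos)
  have hinv : z.im⁻¹ ≤ 1 := inv_le_one_of_one_le₀ (by linarith)
  have hright := mul_re_integral_inv_ofReal_sub_le_im hν hpos (by linarith) hre (s := 1)
  have hleft := mul_re_integral_inv_ofReal_sub_le_im hν hpos (by linarith) hre (s := -1)
  set G := ∫ t, ((t : ℂ) - z)⁻¹ ∂ν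
  obtain ⟨h1, h2⟩ := abs_le.1 hre
  obtain ⟨h3, h4⟩ := abs_le.1 hnorm
  rw [add_re, add_im, abs_le]
  constructor
  · rcases le_total (-k) z.re with h | h
    · linarith
    · linarith [hleft (by norm_num) fun t ht => by linarith [ht.1]]
  · rcases le_total z.re k with h | h
    · linarith
    · linarith [hright (by norm_num) fun t ht => by linarith [ht.2]]

/-- `z ∫ (t - z)⁻¹ dν(t) → -1` as `z → ∞` inside the cone `|re z| ≤ im z`. -/
lemma tendsto_mul_integral_inv_ofReal_sub (ν : Measure ℝ) [IsProbabilityMeasure ν] {u : ℕ → ℂ}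
    (hpos : ∀ j, 0 < (u j).im) (hre : ∀ j, |(u j).re| ≤ (u j).im)
    (hu : Tendsto (fun j => (u j).im) atTop atTop) :
    Tendsto (fun j => u j * ∫ t, ((t : ℂ) - u j)⁻¹ ∂ν) atTop (nhds (-1)) := by
  have hmain : Tendsto (fun j => ∫ t, u j * ((t : ℂ) - u j)⁻¹ ∂ν) atTop
      (nhds (∫ _ : ℝ, (-1 : ℂ) ∂ν)) := by
    refine tendsto_integral_of_dominated_convergence (fun _ => 2)
      (fun j => by fun_prop) (integrable_const _) (fun j => Eventually.of_forall fun t => ?_)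
      (Eventually.of_forall fun t => ?_)
    · have hnorm : ‖u j‖ ≤ 2 * (u j).im := by
        have := norm_le_abs_re_add_abs_im (u j)
        rw [abs_of_pos (hpos j)] at this
        linarith [hre j]
      calc ‖u j * ((t : ℂ) - u j)⁻¹‖ = ‖u j‖ * ‖((t : ℂ) - u j)⁻¹‖ := norm_mul _ _
        _ ≤ 2 * (u j).im * (u j).im⁻¹ := by
            gcongr
            · exact (mul_pos two_pos (hpos j)).le
            · exact norm_inv_ofReal_sub_le t (hpos j)
        _ = 2 := mul_inv_cancel_right₀ (hpos j).ne' 2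
    · have hzero : Tendsto (fun j => (t : ℂ) * ((t : ℂ) - u j)⁻¹) atTop (nhds 0) := by
        refine squeeze_zero_norm (a := fun j => ‖(t : ℂ)‖ * (u j).im⁻¹) (fun j => ?_) ?_
        · rw [norm_mul]
          gcongr
          exact norm_inv_ofReal_sub_le t (hpos j)
        · simpa using (tendsto_inv_atTop_zero.comp hu).const_mul ‖(t : ℂ)‖
      have := hzero.sub_const 1
      rw [zero_sub] at this
      refine this.congr fun j => ?_
      have hne : (t : ℂ) - u j ≠ 0 :=
        norm_pos_iff.1 ((hpos j).trans_le (im_le_norm_ofReal_sub t (hpos j)))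
      field_simp
      ring
  simpa [integral_const_mul] using hmain

/-- If the increments of a sequence converge to `l`, then `u j / j → l`. -/
lemma tendsto_div_natCast_of_tendsto_sub {u : ℕ → ℂ} {l : ℂ}
    (h : Tendsto (fun j => u (j + 1) - u j) atTop (nhds l)) :
    Tendsto (fun j : ℕ => u j / (j : ℂ)) atTop (nhds l) := by
  have hsum := h.cesaro_smul
  have hzero : Tendsto (fun j : ℕ => u 0 / (j : ℂ)) atTop (nhds 0) :=
    tendsto_const_div_atTop_nhds_zero_nat (u 0)
  have hadd := hsum.add hzero
  rw [add_zero] at hadd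
  refine hadd.congr fun j => ?_
  rw [Finset.sum_range_sub, real_smul]
  push_cast
  ring

/-- `(F^{∘j}(z))²/j → -2` as `j → ∞` for `z = (2k+2)i`. -/
theorem iterates_square_over_j_tendsto
    (ν : Measure ℝ) [IsFiniteMeasure ν] (hν1 : ν Set.univ = 1)
    (F : ℂ → ℂ) (hF : ∀ z : ℂ, F z = z + ∫ t, ((t : ℂ) - z)⁻¹ ∂ν)
    (k : ℕ) (hk : 1 ≤ k)
    (hνk : ENNReal.ofReal 0.9 ≤ ν (Set.Icc (-(k : ℝ)) (k : ℝ))) :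
    Filter.Tendsto
      (fun j : ℕ => (F^[j] ((2 * (k : ℝ) + 2) * Complex.I)) ^ 2 / (j : ℂ))
      Filter.atTop (nhds (-2)) := by
  have : IsProbabilityMeasure ν := ⟨hν1⟩
  have hν : 0.9 ≤ ν.real (Icc (-(k : ℝ)) k) :=
    (ENNReal.ofReal_le_iff_le_toReal (measure_ne_top _ _)).1 hνk
  have hk0 : (0 : ℝ) ≤ k := k.cast_nonneg
  set u : ℕ → ℂ := fun j => F^[j] ((2 * (k : ℝ) + 2) * Complex.I) with hu
  have hsucc (j : ℕ) : u (j + 1) = u j + ∫ t, ((t : ℂ) - u j)⁻¹ ∂ν := by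
    rw [← hF]
    exact Function.iterate_succ_apply' F j _
  have hinv (j : ℕ) : 2 * (k : ℝ) + 2 ≤ (u j).im ∧ |(u j).re| ≤ (u j).im ∧
      (j : ℝ) / 2 ≤ (u j).im ^ 2 := by
    induction j with
    | zero =>
      have h0 : u 0 = ((2 * k + 2 : ℝ) : ℂ) * Complex.I := by simp [hu]
      rw [h0, im_ofReal_mul, re_ofReal_mul]
      simp only [I_im, I_re, mul_one, mul_zero, abs_zero, Nat.cast_zero, zero_div]
      exact ⟨le_rfl, by positivity, by positivity⟩
    | succ j ih =>
      obtain ⟨h1, h2, h3⟩ := ih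
      have hpos : 0 < (u j).im := by linarith
      have him := le_im_integral_inv_ofReal_sub hν hpos (by linarith) h2
      have him' : 0 < (4 * (u j).im)⁻¹ := by positivity
      have hcone := abs_re_add_integral_le hk0 hν h1 h2
      rw [hsucc]
      refine ⟨?_, hcone, ?_⟩
      · rw [add_im]
        linarith
      · rw [add_im]
        push_cast
        have hmul : (u j).im * (4 * (u j).im)⁻¹ = 1 / 4 := by field_simp
        nlinarith [mul_le_mul_of_nonneg_left him hpos.le]
  have hpos (j : ℕ) : 0 < (u j).im := by linarith [(hinv j).1]
  have hatTop : Tendsto (fun j => (u j).im) atTop atTop := by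
    have hsq : Tendsto (fun j : ℕ => Real.sqrt ((j : ℝ) / 2)) atTop atTop :=
      Real.tendsto_sqrt_atTop.comp (tendsto_natCast_atTop_atTop.atTop_div_const two_pos)
    exact tendsto_atTop_mono (fun j => Real.sqrt_le_iff.2 ⟨(hpos j).le, (hinv j).2.2⟩) hsq
  have hmul := tendsto_mul_integral_inv_ofReal_sub ν hpos (fun j => (hinv j).2.1) hatTop
  have hzero : Tendsto (fun j => ∫ t, ((t : ℂ) - u j)⁻¹ ∂ν) atTop (nhds 0) :=
    squeeze_zero_norm (fun j => norm_integral_inv_ofReal_sub_le ν (hpos j))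
      (tendsto_inv_atTop_zero.comp hatTop)
  refine tendsto_div_natCast_of_tendsto_sub (u := fun j => u j ^ 2) ?_
  have hlim := (hmul.const_mul 2).add (hzero.pow 2)
  norm_num at hlim
  refine hlim.congr fun j => ?_
  rw [hsucc]
  ring
end

section
/- Let ν be a finite Borel measure on ℝ with ν(ℝ) = 1 and define F : ℂ⁺ → ℂ⁺ by F(z) = z + ∫_ℝ (t − z)⁻¹ dν(t). Let k be a positive integer with ν([−k, k]) ≥ 0.9 and set z = (2k + 2)i. Then lim_{j → ∞} F^{∘j}(z)/√j = i√2; consequently lim_{j → ∞} √(2j) · Im(−1/F^{∘j}(z)) = 1, i.e. Im(−1/F^{∘j}(z)) is asymptotically equivalent to 1/√(2j) as j → ∞. -/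
open MeasureTheory Complex Set Filter

lemma im_le_norm_ofReal_sub_s18 (w : ℂ) (t : ℝ) : w.im ≤ ‖(t : ℂ) - w‖ := by
  have h := abs_im_le_norm ((t : ℂ) - w)
  simp only [sub_im, ofReal_im, zero_sub, abs_neg] at h
  exact (le_abs_self _).trans h

lemma ofReal_sub_ne_zero {w : ℂ} (hw : 0 < w.im) (t : ℝ) : (t : ℂ) - w ≠ 0 :=
  norm_pos_iff.mp (hw.trans_le (im_le_norm_ofReal_sub_s18 w t))

lemma continuous_ofReal_sub_inv {w : ℂ} (hw : 0 < w.im) :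
    Continuous fun t : ℝ => ((t : ℂ) - w)⁻¹ :=
  (continuous_ofReal.sub continuous_const).inv₀ (ofReal_sub_ne_zero hw)

lemma integrable_ofReal_sub_inv (ν : Measure ℝ) [IsFiniteMeasure ν] {w : ℂ} (hw : 0 < w.im) :
    Integrable (fun t : ℝ => ((t : ℂ) - w)⁻¹) ν := by
  refine .of_bound (continuous_ofReal_sub_inv hw).aestronglyMeasurable w.im⁻¹ (.of_forall ?_)
  intro t
  rw [norm_inv]
  exact inv_anti₀ hw (im_le_norm_ofReal_sub_s18 w t)

lemma re_ofReal_sub_inv (w : ℂ) (t : ℝ) :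
    (((t : ℂ) - w)⁻¹).re = (t - w.re) / ((t - w.re) ^ 2 + w.im ^ 2) := by
  simp [inv_re, normSq_apply, pow_two]

lemma im_ofReal_sub_inv (w : ℂ) (t : ℝ) :
    (((t : ℂ) - w)⁻¹).im = w.im / ((t - w.re) ^ 2 + w.im ^ 2) := by
  simp [inv_im, normSq_apply, pow_two]

/-- On the cone `|Re w| ≤ Im w`, the Cauchy transform moves the imaginary part up by a definite
amount, provided at least half of the mass lies in an interval `[-k, k]` with `2 * k ≤ Im w`. -/
lemma im_integral_lower_bound (ν : Measure ℝ) [IsProbabilityMeasure ν] {k : ℝ}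
    (hν : 0.9 ≤ ν.real (Icc (-k) k)) {w : ℂ} (hw : 0 < w.im) (hkw : 2 * k ≤ w.im)
    (hcone : |w.re| ≤ w.im) :
    1 / (4 * w.im) ≤ (∫ t : ℝ, ((t : ℂ) - w)⁻¹ ∂ν).im := by
  have hint := integrable_ofReal_sub_inv ν hw
  have him : (∫ t : ℝ, ((t : ℂ) - w)⁻¹ ∂ν).im = ∫ t : ℝ, (((t : ℂ) - w)⁻¹).im ∂ν :=
    (imCLM.integral_comp_comm hint).symm
  rw [him]
  calc 1 / (4 * w.im) ≤ ν.real (Icc (-k) k) * (1 / (13 / 4 * w.im)) := by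
        have : 1 / (4 * w.im) ≤ 0.9 * (1 / (13 / 4 * w.im)) := by
          rw [mul_one_div, div_le_div_iff₀ (by positivity) (by positivity)]
          nlinarith
        exact this.trans (by gcongr)
    _ = ∫ t, (Icc (-k) k).indicator (fun _ => 1 / (13 / 4 * w.im)) t ∂ν := by
        rw [integral_indicator_const _ measurableSet_Icc, smul_eq_mul]
    _ ≤ _ := by
        refine integral_mono ((integrable_const _).indicator measurableSet_Icc) hint.im ?_
        intro t
        by_cases ht : t ∈ Icc (-k) k
        · simp only [indicator_of_mem ht]
          change _ ≤ (((t : ℂ) - w)⁻¹).im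
          rw [im_ofReal_sub_inv, div_le_div_iff₀ (by positivity) (by positivity)]
          obtain ⟨h1, h2⟩ := abs_le.mp hcone
          obtain ⟨h3, h4⟩ := ht
          have : (t - w.re) ^ 2 ≤ (3 / 2 * w.im) ^ 2 := sq_le_sq' (by linarith) (by linarith)
          nlinarith
        · simp only [indicator_of_notMem ht]
          change _ ≤ (((t : ℂ) - w)⁻¹).im
          rw [im_ofReal_sub_inv]
          positivity

/-- The half-cones `σ * Re w ≤ Im w`, `σ = ± 1`, are preserved. -/
lemma half_cone_invariant (ν : Measure ℝ) [IsProbabilityMeasure ν] {k : ℝ}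
    (hν : 0.9 ≤ ν.real (Icc (-k) k)) {w : ℂ} (hw : 1 ≤ w.im) (hkw : 2 * k ≤ w.im)
    {σ : ℝ} (hσ : σ = 1 ∨ σ = -1) (hcone : σ * w.re ≤ w.im) :
    σ * (w + ∫ t : ℝ, ((t : ℂ) - w)⁻¹ ∂ν).re ≤ (w + ∫ t : ℝ, ((t : ℂ) - w)⁻¹ ∂ν).im := by
  have hw0 : 0 < w.im := by linarith
  have hint := integrable_ofReal_sub_inv ν hw0
  have hσ2 : σ ^ 2 = 1 := by rcases hσ with rfl | rfl <;> norm_num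
  have hre : (∫ t : ℝ, ((t : ℂ) - w)⁻¹ ∂ν).re = ∫ t : ℝ, (((t : ℂ) - w)⁻¹).re ∂ν :=
    (reCLM.integral_comp_comm hint).symm
  have him : (∫ t : ℝ, ((t : ℂ) - w)⁻¹ ∂ν).im = ∫ t : ℝ, (((t : ℂ) - w)⁻¹).im ∂ν :=
    (imCLM.integral_comp_comm hint).symm
  have hintg : Integrable (fun t : ℝ => σ * (((t : ℂ) - w)⁻¹).re - (((t : ℂ) - w)⁻¹).im) ν :=
    (hint.re.const_mul σ).sub hint.im
  have hg : σ * (∫ t : ℝ, ((t : ℂ) - w)⁻¹ ∂ν).re - (∫ t : ℝ, ((t : ℂ) - w)⁻¹ ∂ν).im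
      = ∫ t : ℝ, (σ * (((t : ℂ) - w)⁻¹).re - (((t : ℂ) - w)⁻¹).im) ∂ν := by
    rw [hre, him, ← integral_const_mul]
    exact (integral_sub (hint.re.const_mul σ) hint.im).symm
  have hpt (t : ℝ) : σ * (((t : ℂ) - w)⁻¹).re - (((t : ℂ) - w)⁻¹).im
      = (σ * (t - w.re) - w.im) / ((t - w.re) ^ 2 + w.im ^ 2) := by
    rw [re_ofReal_sub_inv, im_ofReal_sub_inv]; ring
  have hsq (t : ℝ) : (t - w.re) ^ 2 = (σ * (t - w.re)) ^ 2 := by rw [mul_pow, hσ2, one_mul]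
  have hupper (t : ℝ) :
      σ * (((t : ℂ) - w)⁻¹).re - (((t : ℂ) - w)⁻¹).im ≤ 1 / (4 * w.im) := by
    rw [hpt, div_le_div_iff₀ (by positivity) (by positivity), hsq]
    nlinarith [sq_nonneg (σ * (t - w.re) - 2 * w.im), sq_nonneg w.im]
  suffices h : σ * w.re - w.im
      + ∫ t : ℝ, (σ * (((t : ℂ) - w)⁻¹).re - (((t : ℂ) - w)⁻¹).im) ∂ν ≤ 0 by
    rw [← hg] at h
    simp only [add_re, add_im]
    linarith
  rcases le_total (σ * w.re) (w.im / 2) with hx | hx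
  · have h1 : ∫ t : ℝ, (σ * (((t : ℂ) - w)⁻¹).re - (((t : ℂ) - w)⁻¹).im) ∂ν
        ≤ 1 / (4 * w.im) := by
      have := integral_mono hintg (integrable_const (1 / (4 * w.im))) hupper
      simpa using this
    have h2 : 1 / (4 * w.im) ≤ w.im / 2 := by
      rw [div_le_div_iff₀ (by positivity) (by norm_num)]
      nlinarith
    linarith
  · have h1 : ∫ t : ℝ, (σ * (((t : ℂ) - w)⁻¹).re - (((t : ℂ) - w)⁻¹).im) ∂ν
        ≤ ∫ t, (1 / (4 * w.im) - (Icc (-k) k).indicator (fun _ => 2 * (1 / (4 * w.im))) t) ∂ν := by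
      refine integral_mono hintg ((integrable_const _).sub
        ((integrable_const _).indicator measurableSet_Icc)) fun t => ?_
      by_cases ht : t ∈ Icc (-k) k
      · simp only [indicator_of_mem ht]
        have hσt : |σ * t| ≤ k := by
          rcases hσ with rfl | rfl <;> simpa [abs_le] using ht
        obtain ⟨h3, h4⟩ := abs_le.mp hσt
        have hs1 : -(3 / 2 * w.im) ≤ σ * (t - w.re) := by linarith
        have hs2 : σ * (t - w.re) ≤ 0 := by linarith
        rw [hpt, show 1 / (4 * w.im) - 2 * (1 / (4 * w.im)) = (-1) / (4 * w.im) by ring,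
          div_le_div_iff₀ (by positivity) (by positivity), hsq]
        nlinarith [mul_nonneg (neg_nonneg.mpr hs2) (sub_nonneg.mpr hs1)]
      · simp only [indicator_of_notMem ht, sub_zero]
        exact hupper t
    rw [integral_sub (integrable_const _) ((integrable_const _).indicator measurableSet_Icc),
      integral_indicator_const _ measurableSet_Icc] at h1
    simp only [integral_const, probReal_univ, smul_eq_mul, one_mul] at h1
    have h2 : 0.9 * (2 * (1 / (4 * w.im))) ≤ ν.real (Icc (-k) k) * (2 * (1 / (4 * w.im))) := by
      gcongr
    have h3 : 0 < 1 / (4 * w.im) := by positivity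
    linarith

/-- `w * ∫ (t - w)⁻¹ dν(t) → -1` as `w → ∞` nontangentially. -/
lemma tendsto_mul_integral_ofReal_sub_inv (ν : Measure ℝ) [IsProbabilityMeasure ν] {z : ℕ → ℂ}
    (hz : ∀ j, 0 < (z j).im) (hcone : ∀ j, |(z j).re| ≤ (z j).im)
    (hlim : Tendsto (fun j => (z j)⁻¹) atTop (nhds 0)) :
    Tendsto (fun j => z j * ∫ t : ℝ, ((t : ℂ) - z j)⁻¹ ∂ν) atTop (nhds (-1)) := by
  have hz0 (j : ℕ) : z j ≠ 0 := fun h => (hz j).ne' (by simp [h])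
  have key : Tendsto (fun j => ∫ t : ℝ, z j * ((t : ℂ) - z j)⁻¹ ∂ν) atTop
      (nhds (∫ _ : ℝ, (-1 : ℂ) ∂ν)) := by
    refine tendsto_integral_of_dominated_convergence (fun _ => 2)
      (fun j => (continuous_const.mul (continuous_ofReal_sub_inv (hz j))).aestronglyMeasurable)
      (integrable_const _) (fun j => .of_forall fun t => ?_) (.of_forall fun t => ?_)
    · have h1 := im_le_norm_ofReal_sub_s18 (z j) t
      have h2 := norm_le_abs_re_add_abs_im (z j)
      rw [abs_of_pos (hz j)] at h2
      rw [norm_mul, norm_inv, ← div_eq_mul_inv, div_le_iff₀ ((hz j).trans_le h1)]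
      linarith [hcone j]
    · have h1 : Tendsto (fun j => ((t : ℂ) * (z j)⁻¹ - 1)⁻¹) atTop
          (nhds (((t : ℂ) * 0 - 1)⁻¹)) :=
        ((hlim.const_mul _).sub_const 1).inv₀ (by simp)
      have h2 : ((t : ℂ) * 0 - 1)⁻¹ = -1 := by norm_num
      rw [h2] at h1
      refine h1.congr fun j => ?_
      rw [← inv_inv (z j * _), mul_inv, inv_inv]
      congr 1
      have := hz0 j
      field_simp
  simpa [integral_const_mul] using key

/-- If the increments of `z j ^ 2` tend to `-2` and `z j` stays in the upper half-plane, then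
`z j / √j` tends to `i √2`. -/
lemma tendsto_div_sqrt_of_tendsto_sq_sub {z : ℕ → ℂ} (hz : ∀ j, 0 ≤ (z j).im)
    (h : Tendsto (fun j => z (j + 1) ^ 2 - z j ^ 2) atTop (nhds (-2))) :
    Tendsto (fun j : ℕ => z j / (Real.sqrt j : ℂ)) atTop (nhds (I * (Real.sqrt 2 : ℂ))) := by
  have hs2 : ((Real.sqrt 2 : ℝ) : ℂ) ^ 2 = 2 := by
    rw [← ofReal_pow, Real.sq_sqrt (by norm_num)]; norm_num
  have h1 : Tendsto (fun j : ℕ => (z j / (Real.sqrt j : ℂ)) ^ 2) atTop (nhds (-2)) := by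
    have hinv : Tendsto (fun j : ℕ => ((j : ℝ) : ℂ)⁻¹ * z 0 ^ 2) atTop (nhds (0 * z 0 ^ 2)) := by
      refine Tendsto.mul_const _ ?_
      have := (continuous_ofReal.tendsto 0).comp (tendsto_inv_atTop_nhds_zero_nat (𝕜 := ℝ))
      simpa [Function.comp_def] using this
    have := h.cesaro_smul.add hinv
    rw [zero_mul, add_zero] at this
    refine this.congr fun j => ?_
    rw [Finset.sum_range_sub (fun j => z j ^ 2), div_pow, ← ofReal_pow,
      Real.sq_sqrt (Nat.cast_nonneg j), real_smul, ofReal_inv]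
    ring
  rw [tendsto_iff_norm_sub_tendsto_zero] at h1 ⊢
  have h2 := h1.div_const (Real.sqrt 2)
  rw [zero_div] at h2
  refine squeeze_zero (fun _ => norm_nonneg _) (fun j => ?_) h2
  have hpos : 0 < Real.sqrt 2 := by positivity
  rw [le_div_iff₀ hpos]
  have hfac : (z j / (Real.sqrt j : ℂ)) ^ 2 - -2
      = (z j / (Real.sqrt j : ℂ) - I * (Real.sqrt 2 : ℂ))
        * (z j / (Real.sqrt j : ℂ) + I * (Real.sqrt 2 : ℂ)) := by
    linear_combination -hs2 + (Real.sqrt 2 : ℂ) ^ 2 * I_sq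
  rw [hfac, norm_mul]
  gcongr
  refine le_trans ?_ ((le_abs_self _).trans (abs_im_le_norm _))
  rw [add_im, div_ofReal_im]
  simp only [I_mul_im, ofReal_re]
  have := div_nonneg (hz j) (Real.sqrt_nonneg j)
  linarith

/-- `F^{∘j}(z)/√j → i√2`, and consequently `Im(-1/F^{∘j}(z)) ∼ 1/√(2j)`,
for `z = (2k+2)i`. -/
theorem iterates_over_sqrt_j_tendsto
    (ν : Measure ℝ) [IsFiniteMeasure ν] (hν1 : ν Set.univ = 1)
    (F : ℂ → ℂ) (hF : ∀ z : ℂ, F z = z + ∫ t, ((t : ℂ) - z)⁻¹ ∂ν)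
    (k : ℕ) (hk : 1 ≤ k)
    (hνk : ENNReal.ofReal 0.9 ≤ ν (Set.Icc (-(k : ℝ)) (k : ℝ))) :
    Filter.Tendsto
      (fun j : ℕ => F^[j] ((2 * (k : ℝ) + 2) * Complex.I) / (Real.sqrt j : ℂ))
      Filter.atTop (nhds (Complex.I * (Real.sqrt 2 : ℂ))) ∧
    Filter.Tendsto
      (fun j : ℕ =>
        Real.sqrt (2 * j) * (-(F^[j] ((2 * (k : ℝ) + 2) * Complex.I))⁻¹).im)
      Filter.atTop (nhds 1) := by
  have : IsProbabilityMeasure ν := ⟨hν1⟩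
  have hν : 0.9 ≤ ν.real (Icc (-(k : ℝ)) k) :=
    (ENNReal.ofReal_le_iff_le_toReal (measure_ne_top _ _)).mp hνk
  have hk' : (1 : ℝ) ≤ k := by exact_mod_cast hk
  set z : ℕ → ℂ := fun j => F^[j] ((2 * (k : ℝ) + 2) * I) with hzdef
  have hz0 : z 0 = ((2 * k + 2 : ℝ) : ℂ) * I := by simp [hzdef]
  have hstep (j : ℕ) : z (j + 1) = z j + ∫ t : ℝ, ((t : ℂ) - z j)⁻¹ ∂ν := by
    simp only [hzdef, Function.iterate_succ_apply']
    exact hF _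
  have hinv (j : ℕ) : 2 * (k : ℝ) + 2 ≤ (z j).im ∧ |(z j).re| ≤ (z j).im ∧
      (j : ℝ) / 2 ≤ (z j).im ^ 2 := by
    induction j with
    | zero =>
      rw [hz0, re_ofReal_mul, im_ofReal_mul]
      simp only [I_re, I_im, mul_zero, mul_one, abs_zero, le_refl, true_and, Nat.cast_zero,
        zero_div]
      constructor <;> positivity
    | succ j ih =>
      obtain ⟨h1, h2, h3⟩ := ih
      have hpos : 0 < (z j).im := by linarith
      have hlow := im_integral_lower_bound ν hν hpos (by linarith) h2
      have hone : (z j).im * (1 / (4 * (z j).im)) = 1 / 4 := by field_simp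
      have hfrac : 0 < 1 / (4 * (z j).im) := by positivity
      have hc1 := half_cone_invariant ν hν (w := z j) (by linarith) (by linarith) (σ := 1)
        (.inl rfl) (by linarith [(abs_le.mp h2).2])
      have hc2 := half_cone_invariant ν hν (w := z j) (by linarith) (by linarith) (σ := -1)
        (.inr rfl) (by linarith [(abs_le.mp h2).1])
      rw [← hstep] at hc1 hc2
      have him : (z (j + 1)).im = (z j).im + (∫ t : ℝ, ((t : ℂ) - z j)⁻¹ ∂ν).im := by
        rw [hstep, add_im]
      refine ⟨by linarith, abs_le.mpr ⟨by linarith, by linarith⟩, ?_⟩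
      have : (z j).im + 1 / (4 * (z j).im) ≤ (z (j + 1)).im := by linarith
      have := pow_le_pow_left₀ (by positivity) this 2
      push_cast
      nlinarith
  have hpos (j : ℕ) : 0 < (z j).im := by linarith [(hinv j).1]
  have hinvlim : Tendsto (fun j => (z j)⁻¹) atTop (nhds 0) := by
    refine tendsto_inv₀_cobounded.comp (tendsto_norm_atTop_iff_cobounded.mp ?_)
    have h1 : Tendsto (fun j : ℕ => Real.sqrt ((j : ℝ) / 2)) atTop atTop :=
      Real.tendsto_sqrt_atTop.comp (tendsto_natCast_atTop_atTop.atTop_div_const (by norm_num))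
    refine tendsto_atTop_mono (fun j => ?_) h1
    calc Real.sqrt ((j : ℝ) / 2) ≤ (z j).im := (Real.sqrt_le_left (hpos j).le).mpr (hinv j).2.2
      _ ≤ ‖z j‖ := (le_abs_self _).trans (abs_im_le_norm _)
  have hmul := tendsto_mul_integral_ofReal_sub_inv ν hpos (fun j => (hinv j).2.1) hinvlim
  have hsq : Tendsto (fun j => z (j + 1) ^ 2 - z j ^ 2) atTop (nhds (-2)) := by
    have h1 := (hmul.const_mul 2).add ((hmul.mul hinvlim).pow 2)
    have h2 : (2 : ℂ) * -1 + (-1 * 0) ^ 2 = -2 := by norm_num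
    rw [h2] at h1
    refine h1.congr fun j => ?_
    have : z j ≠ 0 := fun h => (hpos j).ne' (by simp [h])
    rw [hstep]
    field_simp
    ring
  have hmain := tendsto_div_sqrt_of_tendsto_sq_sub (fun j => (hpos j).le) hsq
  refine ⟨hmain, ?_⟩
  have hs2 : ((Real.sqrt 2 : ℝ) : ℂ) ≠ 0 := by
    rw [Ne, ofReal_eq_zero]; positivity
  have h1 := (continuous_im.tendsto _).comp
    ((hmain.inv₀ (mul_ne_zero I_ne_zero hs2)).const_mul (-(Real.sqrt 2 : ℂ)))
  have h2 : (-(Real.sqrt 2 : ℂ) * (I * (Real.sqrt 2 : ℂ))⁻¹).im = 1 := by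
    have : -(Real.sqrt 2 : ℂ) * (I * (Real.sqrt 2 : ℂ))⁻¹ = I := by
      rw [mul_inv, inv_I]
      field_simp
    rw [this, I_im]
  rw [h2] at h1
  refine h1.congr fun j => ?_
  rw [Real.sqrt_mul (by norm_num), ← im_ofReal_mul, ofReal_mul]
  simp only [Function.comp_apply]
  congr 1
  rw [inv_div]
  ring
end
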